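/- For every complex q with 0 < |q| < 1: ∑_{n≥1} (q^n − 2q^{2n} + 2q^{3n} − q^{4n})/(1 − q^{5n}) = (1/10)·(q^2, q^3, q^5; q^5)_∞^2 / (q, q^4; q^5)_∞^3 + (7q/10)·(q, q^4, q^5; q^5)_∞^2 / (q^2, q^3; q^5)_∞^3 − 1/10. -/

import Mathlib

/-!
Common definitions: for a partition `π` of `n`,
`numParts` is the number of parts, `largestPart` the largest part,
`omegaOnes` the number of parts equal to 1, `rank` and `crank` the
Dyson rank and Andrews–Garvan crank.  `NT m j n` is the total number of
parts over partitions of `n` with rank ≡ m (mod j), and `Mw m j n` is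
the total number of ones over partitions of `n` with crank ≡ m (mod j).
`poch a q = (a; q)_∞ = ∏_{n ≥ 0} (1 - a qⁿ)`.
-/

namespace Beck

/-- number of parts of a partition -/
def numParts {n : ℕ} (π : n.Partition) : ℕ := Multiset.card π.parts

/-- largest part of a partition (0 for the empty partition) -/
def largestPart {n : ℕ} (π : n.Partition) : ℕ := π.parts.sup

/-- number of ones in a partition -/
def omegaOnes {n : ℕ} (π : n.Partition) : ℕ := π.parts.count 1

/-- number of parts strictly larger than the number of ones -/
def muParts {n : ℕ} (π : n.Partition) : ℕ :=
  Multiset.card (π.parts.filter fun x => omegaOnes π < x)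

/-- Dyson's rank: largest part minus number of parts -/
def rank {n : ℕ} (π : n.Partition) : ℤ :=
  (largestPart π : ℤ) - (numParts π : ℤ)

/-- the Andrews–Garvan crank -/
def crank {n : ℕ} (π : n.Partition) : ℤ :=
  if omegaOnes π = 0 then (largestPart π : ℤ)
  else (muParts π : ℤ) - (omegaOnes π : ℤ)

/-- `NT m j n`: total number of parts in partitions of `n` with rank ≡ m (mod j) -/
def NT (m j n : ℕ) : ℤ :=
  ∑ π : n.Partition,
    if rank π % (j : ℤ) = (m : ℤ) % (j : ℤ) then (numParts π : ℤ) else 0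

/-- `Mw m j n`: total number of ones in partitions of `n` with crank ≡ m (mod j) -/
def Mw (m j n : ℕ) : ℤ :=
  ∑ π : n.Partition,
    if crank π % (j : ℤ) = (m : ℤ) % (j : ℤ) then (omegaOnes π : ℤ) else 0

/-- `(a; q)_∞ = ∏_{n ≥ 0} (1 - a qⁿ)` -/
noncomputable def poch (a q : ℂ) : ℂ := ∏' n : ℕ, (1 - a * q ^ n)

open Filter Topology

section Pochhammer

variable {p : ℂ}

lemma summable_mul_pow (hp : ‖p‖ < 1) (a : ℂ) : Summable fun n : ℕ ↦ a * p ^ n :=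
  (summable_geometric_of_norm_lt_one hp).mul_left a

lemma multipliable_poch (hp : ‖p‖ < 1) (a : ℂ) : Multipliable fun n : ℕ ↦ 1 - a * p ^ n := by
  simpa [sub_eq_add_neg] using multipliable_one_add_of_summable (summable_mul_pow hp a).neg.norm

lemma poch_ne_zero (hp : ‖p‖ < 1) {a : ℂ} (ha : ∀ n : ℕ, a * p ^ n ≠ 1) : poch a p ≠ 0 := by
  have := tprod_one_add_ne_zero_of_summable (f := fun n : ℕ ↦ -(a * p ^ n))
    (fun n ↦ by rw [← sub_eq_add_neg]; exact sub_ne_zero.2 (ha n).symm)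
    (summable_mul_pow hp a).neg.norm
  simpa [poch, sub_eq_add_neg] using this

lemma poch_eq_zero {a : ℂ} {n : ℕ} (ha : a * p ^ n = 1) : poch a p = 0 :=
  tprod_of_exists_eq_zero ⟨n, by simp [ha]⟩

lemma mul_pow_ne_one_of_poch_ne_zero {a : ℂ} (ha : poch a p ≠ 0) (n : ℕ) : a * p ^ n ≠ 1 :=
  fun h ↦ ha (poch_eq_zero h)

lemma poch_eq_one_sub_mul (hp : ‖p‖ < 1) (a : ℂ) : poch a p = (1 - a) * poch (a * p) p := by
  by_cases ha : a = 1
  · simpa [ha] using poch_eq_zero (p := p) (a := a) (n := 0) (by simp [ha])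
  have := (multipliable_poch hp (a * p))
  rw [poch, poch, tprod_eq_zero_mul' (by simpa [pow_succ', mul_assoc] using this)]
  simp [pow_succ', mul_assoc]

lemma tendsto_prod_poch (hp : ‖p‖ < 1) (a : ℂ) :
    Tendsto (fun n ↦ ∏ k ∈ Finset.range n, (1 - a * p ^ k)) atTop (𝓝 (poch a p)) :=
  (multipliable_poch hp a).hasProd.tendsto_prod_nat

lemma hasProdLocallyUniformlyOn_poch (hp : ‖p‖ < 1) (r : ℝ) :
    HasProdLocallyUniformlyOn (fun (n : ℕ) a ↦ 1 - a * p ^ n) (poch · p) (Metric.ball 0 r) := by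
  have := Summable.hasProdLocallyUniformlyOn_nat_one_add (f := fun (n : ℕ) (a : ℂ) ↦ -(a * p ^ n))
    (Metric.isOpen_ball (x := (0 : ℂ)) (ε := r))
    ((summable_geometric_of_lt_one (norm_nonneg p) hp).mul_left r)
    (.of_forall fun n x hx ↦ by
      rw [norm_neg, norm_mul, norm_pow]
      gcongr
      exact (mem_ball_zero_iff.1 hx).le) (fun n ↦ by fun_prop)
  simpa [poch, sub_eq_add_neg] using! this

lemma differentiable_poch (hp : ‖p‖ < 1) : Differentiable ℂ (poch · p) := fun a ↦
  ((hasProdLocallyUniformlyOn_poch hp (‖a‖ + 1)).differentiableOn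
    (.of_forall fun _ ↦ by simpa [Finset.prod_fn] using
      DifferentiableOn.finsetProd (fun _ _ ↦ by fun_prop)) Metric.isOpen_ball).differentiableAt
    (Metric.isOpen_ball.mem_nhds (by simp))

/-- The Lambert series `∑ a pⁿ / (1 - a pⁿ)`, which is minus the Euler derivative in `a` of
`log (a; p)_∞`. -/
noncomputable def lambert (a p : ℂ) : ℂ := ∑' n : ℕ, a * p ^ n / (1 - a * p ^ n)

lemma summable_lambert (hp : ‖p‖ < 1) (a : ℂ) :
    Summable fun n : ℕ ↦ a * p ^ n / (1 - a * p ^ n) := by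
  have h1 : Tendsto (fun n : ℕ ↦ (1 - a * p ^ n)⁻¹) atTop (𝓝 1) := by
    have := ((tendsto_pow_atTop_nhds_zero_of_norm_lt_one hp).const_mul a).const_sub 1
    simpa using this.inv₀ (by simp)
  refine summable_of_isBigO_nat (summable_mul_pow hp a).norm ?_
  simpa [div_eq_mul_inv] using
    (Asymptotics.isBigO_refl (fun n : ℕ ↦ a * p ^ n) atTop).norm_right.mul (h1.isBigO_one ℝ)

lemma lambert_eq_add (hp : ‖p‖ < 1) (a : ℂ) : lambert a p = a / (1 - a) + lambert (a * p) p := by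
  rw [lambert, (summable_lambert hp a).tsum_eq_zero_add]
  simp [lambert, pow_succ', mul_assoc]

lemma hasDerivAt_poch (hp : ‖p‖ < 1) {a : ℂ} (ha0 : a ≠ 0) (ha : poch a p ≠ 0) :
    HasDerivAt (poch · p) (-(lambert a p / a * poch a p)) a := by
  have hne := mul_pow_ne_one_of_poch_ne_zero ha
  have hld (n : ℕ) : logDeriv (fun a ↦ 1 - a * p ^ n) a = -a⁻¹ * (a * p ^ n / (1 - a * p ^ n)) := by
    have := sub_ne_zero.2 (hne n).symm
    rw [logDeriv_apply]
    simp
    field_simp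
  have h := logDeriv_tprod_eq_tsum (f := fun (n : ℕ) a ↦ 1 - a * p ^ n)
    (Metric.isOpen_ball (x := (0 : ℂ)) (ε := ‖a‖ + 1)) (x := a) (by simp)
    (fun n ↦ sub_ne_zero.2 (hne n).symm) (fun n ↦ by fun_prop)
    (by simpa only [hld] using (summable_lambert hp a).mul_left _)
    (hasProdLocallyUniformlyOn_poch hp _).multipliableLocallyUniformlyOn ha
  simp only [hld, tsum_mul_left] at h
  change deriv (poch · p) a / poch a p = -a⁻¹ * lambert a p at h
  rw [div_eq_iff ha] at h
  convert! (differentiable_poch hp a).hasDerivAt using 1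
  rw [h]
  ring

end Pochhammer

section Theta

variable {p : ℂ}

/-- The modified theta function `(z, p/z; p)_∞`. -/
noncomputable def theta (z p : ℂ) : ℂ := poch z p * poch (p / z) p

/-- The Euler derivative of `log (theta z p)` in `z`. -/
noncomputable def thetaLogDeriv (z p : ℂ) : ℂ := lambert (p / z) p - lambert z p

lemma theta_eq_one_sub_mul (hp : ‖p‖ < 1) (z : ℂ) :
    theta z p = (1 - z) * (poch (z * p) p * poch (p / z) p) := by
  rw [theta, poch_eq_one_sub_mul hp z, mul_assoc]

lemma theta_inv (hp : ‖p‖ < 1) {z : ℂ} (hz : z ≠ 0) : theta z⁻¹ p = -theta z p / z := by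
  rw [theta_eq_one_sub_mul hp z⁻¹, theta_eq_one_sub_mul hp z, div_inv_eq_mul, mul_comm p z,
    mul_comm z⁻¹ p, ← div_eq_mul_inv]
  field_simp
  ring

lemma theta_div_self (hp0 : p ≠ 0) (z : ℂ) : theta (p / z) p = theta z p := by
  rw [theta, theta, div_div_cancel₀ hp0, mul_comm]

lemma theta_mul_self (hp0 : p ≠ 0) (hp : ‖p‖ < 1) {z : ℂ} (hz : z ≠ 0) :
    theta (p * z) p = -theta z p / z := by
  rw [← theta_inv hp hz, ← theta_div_self hp0 z⁻¹, div_inv_eq_mul]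

lemma thetaLogDeriv_div_self (hp0 : p ≠ 0) (z : ℂ) :
    thetaLogDeriv (p / z) p = -thetaLogDeriv z p := by
  rw [thetaLogDeriv, thetaLogDeriv, div_div_cancel₀ hp0, neg_sub]

lemma thetaLogDeriv_mul_self (hp0 : p ≠ 0) (hp : ‖p‖ < 1) {z : ℂ} (hz : z ≠ 0) (hz1 : z ≠ 1) :
    thetaLogDeriv (p * z) p = thetaLogDeriv z p - 1 := by
  have h1 : 1 - z ≠ 0 := sub_ne_zero.2 hz1.symm
  have h2 : z - 1 ≠ 0 := sub_ne_zero.2 hz1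
  rw [thetaLogDeriv, thetaLogDeriv, lambert_eq_add hp z, lambert_eq_add hp (p / (p * z)),
    mul_comm p z, show p / (z * p) * p = p / z by field_simp, show p / (z * p) = 1 / z by field_simp]
  have : 1 / z / (1 - 1 / z) = 1 / (z - 1) := by field_simp
  rw [this, ← neg_sub 1 z]
  field_simp
  ring

lemma thetaLogDeriv_inv (hp0 : p ≠ 0) (hp : ‖p‖ < 1) {z : ℂ} (hz : z ≠ 0) (hz1 : z ≠ 1) :
    thetaLogDeriv z⁻¹ p = 1 - thetaLogDeriv z p := by
  have h := thetaLogDeriv_mul_self hp0 hp (inv_ne_zero hz) (by simpa using hz1)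
  rw [← div_eq_mul_inv, thetaLogDeriv_div_self hp0] at h
  linear_combination -h

lemma hasDerivAt_theta {z : ℂ} (hp0 : p ≠ 0) (hp : ‖p‖ < 1) (hz : z ≠ 0) (h : theta z p ≠ 0) :
    HasDerivAt (theta · p) (thetaLogDeriv z p / z * theta z p) z := by
  obtain ⟨h1, h2⟩ := mul_ne_zero_iff.1 h
  have hd : HasDerivAt (fun z ↦ p / z) (-p / z ^ 2) z := by
    simpa [div_eq_mul_inv] using (hasDerivAt_inv hz).const_mul p
  have := (hasDerivAt_poch hp hz h1).mul
    ((hasDerivAt_poch hp (div_ne_zero hp0 hz) h2).comp z hd)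
  refine this.congr_deriv ?_
  simp only [theta, thetaLogDeriv, Function.comp]
  field_simp
  ring

lemma hasDerivAt_theta_one (hp : ‖p‖ < 1) :
    HasDerivAt (theta · p) (-poch p p ^ 2) 1 := by
  have hd : DifferentiableAt ℂ (fun z ↦ poch (z * p) p * poch (p / z) p) 1 := by
    have h1 : DifferentiableAt ℂ (fun z ↦ poch (z * p) p) 1 :=
      (differentiable_poch hp _).comp 1 (by fun_prop)
    have h2 : DifferentiableAt ℂ (fun z ↦ poch (p / z) p) 1 :=
      (differentiable_poch hp _).comp 1
        (DifferentiableAt.div (by fun_prop) (by fun_prop) one_ne_zero)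
    exact h1.mul h2
  have := ((hasDerivAt_id (1 : ℂ)).const_sub 1).mul hd.hasDerivAt
  refine (this.congr_deriv ?_).congr_of_eventuallyEq
    (.of_forall fun z ↦ theta_eq_one_sub_mul hp z)
  simp [sq]

end Theta

section JacobiTripleProduct

open Finset

variable {p : ℂ}

/-- The Gaussian binomial coefficient as a function of `p`. -/
noncomputable def gaussBinom (p : ℂ) : ℕ → ℕ → ℂ
  | _, 0 => 1
  | 0, _ + 1 => 0
  | n + 1, k + 1 => p ^ (k + 1) * gaussBinom p n (k + 1) + gaussBinom p n k

@[simp] lemma gaussBinom_zero_right (n : ℕ) : gaussBinom p n 0 = 1 := by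
  cases n <;> simp [gaussBinom]

lemma gaussBinom_eq_zero {n k : ℕ} (h : n < k) : gaussBinom p n k = 0 := by
  induction n generalizing k with
  | zero =>
    obtain ⟨k, rfl⟩ := Nat.exists_eq_succ_of_ne_zero h.ne'
    simp [gaussBinom]
  | succ n ih =>
    obtain ⟨k, rfl⟩ := Nat.exists_eq_succ_of_ne_zero (Nat.ne_zero_of_lt h)
    rw [gaussBinom, ih (by lia), ih (by lia), mul_zero, add_zero]

/-- The Gaussian binomial theorem. -/
lemma prod_one_add_mul_pow (n : ℕ) (x : ℂ) :
    ∏ k ∈ range n, (1 + x * p ^ k) =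
      ∑ k ∈ range (n + 1), gaussBinom p n k * p ^ k.choose 2 * x ^ k := by
  induction n generalizing x with
  | zero => simp
  | succ n ih =>
    have h1 : ∏ k ∈ range (n + 1), (1 + x * p ^ k) =
        (1 + x) * ∏ k ∈ range n, (1 + (x * p) * p ^ k) := by
      rw [prod_range_succ', mul_comm]
      simp [pow_succ', mul_assoc]
    have h2 : ∑ k ∈ range (n + 1), gaussBinom p n k * p ^ k.choose 2 * (x * p) ^ k =
        ∑ k ∈ range (n + 1), gaussBinom p n (k + 1) * p ^ (k + 1).choose 2 * (x * p) ^ (k + 1)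
          + 1 := by
      have := sum_range_succ' (fun k ↦ gaussBinom p n k * p ^ k.choose 2 * (x * p) ^ k) (n + 1)
      rw [sum_range_succ, gaussBinom_eq_zero n.lt_succ_self] at this
      simpa using this
    rw [h1, ih, one_add_mul, mul_sum, sum_range_succ' _ (n + 1), h2, add_right_comm,
      ← sum_add_distrib]
    simp only [gaussBinom_zero_right, Nat.choose_zero_succ, pow_zero, mul_one]
    congr 1
    refine sum_congr rfl fun k _ ↦ ?_
    rw [gaussBinom, Nat.choose_succ_succ' k 1, Nat.choose_one_right]
    ring

lemma gaussBinom_mul_prod (k m : ℕ) :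
    gaussBinom p (k + m) k * (∏ i ∈ range k, (1 - p * p ^ i)) * ∏ i ∈ range m, (1 - p * p ^ i) =
      ∏ i ∈ range (k + m), (1 - p * p ^ i) := by
  induction hN : k + m generalizing k m with
  | zero =>
    obtain ⟨rfl, rfl⟩ : k = 0 ∧ m = 0 := by lia
    simp
  | succ N ih =>
    rcases k with - | k
    · obtain rfl : m = N + 1 := by lia
      simp
    rcases m with - | m
    · obtain rfl : k = N := by lia
      have := ih k 0 rfl
      simp only [range_zero, prod_empty, mul_one] at this ⊢
      rw [gaussBinom, gaussBinom_eq_zero k.lt_succ_self, prod_range_succ, mul_zero, zero_add,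
        ← mul_assoc, this]
    · have h1 := ih (k + 1) m (by lia)
      have h2 := ih k (m + 1) (by lia)
      rw [gaussBinom, prod_range_succ _ N, ← show k + 1 + m = N by lia]
      rw [← show k + 1 + m = N by lia] at h1 h2
      rw [prod_range_succ _ k] at h1 ⊢
      rw [prod_range_succ _ m] at h2 ⊢
      linear_combination (1 - p * p ^ m) * p ^ (k + 1) * h1 + (1 - p * p ^ k) * h2

lemma poch_self_ne_zero (hp : ‖p‖ < 1) : poch p p ≠ 0 :=
  poch_ne_zero hp fun n h ↦ by
    have : ‖p ^ (n + 1)‖ < 1 := by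
      rw [norm_pow]; exact pow_lt_one₀ (norm_nonneg _) hp n.succ_ne_zero
    rw [pow_succ', h] at this
    simp at this

lemma prod_one_sub_pow_ne_zero (hp : ‖p‖ < 1) (n : ℕ) : ∏ i ∈ range n, (1 - p * p ^ i) ≠ 0 :=
  prod_ne_zero_iff.2 fun i _ ↦
    sub_ne_zero.2 (mul_pow_ne_one_of_poch_ne_zero (poch_self_ne_zero hp) i).symm

lemma gaussBinom_eq_div (hp : ‖p‖ < 1) (k m : ℕ) :
    gaussBinom p (k + m) k = (∏ i ∈ range (k + m), (1 - p * p ^ i)) *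
      (∏ i ∈ range k, (1 - p * p ^ i))⁻¹ * (∏ i ∈ range m, (1 - p * p ^ i))⁻¹ := by
  have h1 := prod_one_sub_pow_ne_zero hp k
  have h2 := prod_one_sub_pow_ne_zero hp m
  rw [← gaussBinom_mul_prod]
  field_simp

lemma exists_norm_gaussBinom_le (hp : ‖p‖ < 1) : ∃ C : ℝ, ∀ n k, ‖gaussBinom p n k‖ ≤ C := by
  have h := tendsto_prod_poch hp p
  obtain ⟨A, hA⟩ := (Metric.isBounded_range_of_tendsto _ h).exists_norm_le
  obtain ⟨B, hB⟩ := (Metric.isBounded_range_of_tendsto _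
    (h.inv₀ (poch_self_ne_zero hp))).exists_norm_le
  simp only [Set.forall_mem_range] at hA hB
  have hA0 := (norm_nonneg _).trans (hA 0)
  have hB0 := (norm_nonneg _).trans (hB 0)
  refine ⟨A * B * B, fun n k ↦ ?_⟩
  rcases lt_or_ge n k with hn | hn
  · rw [gaussBinom_eq_zero hn, norm_zero]
    positivity
  · obtain ⟨m, rfl⟩ := Nat.exists_eq_add_of_le hn
    rw [gaussBinom_eq_div hp, norm_mul, norm_mul]
    gcongr
    exacts [hA _, hB _, hB _]

/-- The triangular number `j (j - 1) / 2`. -/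
def triangle (j : ℤ) : ℤ := j * (j - 1) / 2

lemma two_mul_triangle (j : ℤ) : 2 * triangle j = j * (j - 1) :=
  Int.mul_ediv_cancel' (Int.even_mul_pred_self j).two_dvd

lemma triangle_succ (j : ℤ) : triangle (j + 1) = triangle j + j := by
  linarith [two_mul_triangle j, two_mul_triangle (j + 1)]

/-- The `j`-th term of the bilateral series of the Jacobi triple product. -/
noncomputable def thetaTerm (z p : ℂ) (j : ℤ) : ℂ := p ^ triangle j * (-z) ^ j

lemma thetaTerm_succ (hp0 : p ≠ 0) {z : ℂ} (hz : z ≠ 0) (j : ℤ) :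
    thetaTerm z p (j + 1) = thetaTerm z p j * (p ^ j * -z) := by
  rw [thetaTerm, thetaTerm, triangle_succ, zpow_add₀ hp0, zpow_add_one₀ (neg_ne_zero.2 hz)]
  ring

lemma thetaTerm_neg (hp0 : p ≠ 0) (z : ℂ) (j : ℤ) :
    thetaTerm z p (-j) = thetaTerm (p / z) p j := by
  have h : triangle (-j) = triangle j + j := by
    linarith [two_mul_triangle j, two_mul_triangle (-j)]
  rw [thetaTerm, thetaTerm, h, zpow_add₀ hp0, show -(p / z) = p * (-z)⁻¹ by ring, mul_zpow,
    inv_zpow', mul_assoc]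

lemma summable_thetaTerm_nat (hp0 : p ≠ 0) (hp : ‖p‖ < 1) {z : ℂ} (hz : z ≠ 0) :
    Summable fun n : ℕ ↦ thetaTerm z p n := by
  have hne (n : ℕ) : thetaTerm z p n ≠ 0 :=
    mul_ne_zero (zpow_ne_zero _ hp0) (zpow_ne_zero _ (neg_ne_zero.2 hz))
  refine summable_of_ratio_test_tendsto_lt_one zero_lt_one (.of_forall hne) ?_
  have : Tendsto (fun n : ℕ ↦ ‖p ^ n * -z‖) atTop (𝓝 0) := by
    simpa using ((tendsto_pow_atTop_nhds_zero_of_norm_lt_one hp).mul_const (-z)).norm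
  refine this.congr fun n ↦ ?_
  rw [eq_div_iff (norm_ne_zero_iff.2 (hne n)), ← norm_mul, Nat.cast_succ, thetaTerm_succ hp0 hz,
    zpow_natCast, mul_comm]

lemma summable_thetaTerm (hp0 : p ≠ 0) (hp : ‖p‖ < 1) {z : ℂ} (hz : z ≠ 0) :
    Summable (thetaTerm z p) := by
  refine .of_nat_of_neg (summable_thetaTerm_nat hp0 hp hz) ?_
  simpa only [thetaTerm_neg hp0] using summable_thetaTerm_nat hp0 hp (div_ne_zero hp0 hz)

lemma thetaTerm_neg_mul_prod (hp0 : p ≠ 0) {z : ℂ} (hz : z ≠ 0) (n : ℕ) :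
    thetaTerm z p (-n) * ∏ k ∈ range n, (1 + -z * p ^ (-n : ℤ) * p ^ k) =
      ∏ k ∈ range n, (1 - p / z * p ^ k) := by
  induction n with
  | zero => simp [thetaTerm, triangle]
  | succ n ih =>
    have h := thetaTerm_succ hp0 hz (-(n + 1 : ℕ))
    rw [show (-(n + 1 : ℕ) + 1 : ℤ) = -n by push_cast; ring] at h
    have h' : (p : ℂ) ^ (-(n + 1 : ℕ) : ℤ) * p = p ^ (-n : ℤ) := by
      rw [← zpow_add_one₀ hp0]; congr 1; push_cast; ring
    have h'' : (p : ℂ) ^ (-(n + 1 : ℕ) : ℤ) * (p * p ^ n) = 1 := by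
      rw [← pow_succ', ← zpow_natCast, ← zpow_add₀ hp0]; simp
    rw [prod_range_succ', prod_range_succ _ n, ← ih, h]
    simp only [pow_succ', pow_zero, mul_one, ← h', mul_assoc]
    have : z * (p / z * p ^ n) = p * p ^ n := by field_simp
    set X := ∏ x ∈ range n, (1 + -z * (p ^ (-(n + 1 : ℕ) : ℤ) * (p * p ^ x)))
    linear_combination thetaTerm z p (-(n + 1 : ℕ)) * X * (p ^ (-(n + 1 : ℕ) : ℤ) * -this + -h'')

lemma thetaTerm_neg_mul_pow (hp0 : p ≠ 0) {z : ℂ} (hz : z ≠ 0) (n k : ℕ) :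
    thetaTerm z p (-n) * (p ^ k.choose 2 * (-z * p ^ (-n : ℤ)) ^ k) = thetaTerm z p (k - n) := by
  induction k with
  | zero => simp
  | succ k ih =>
    rw [show ((k + 1 : ℕ) - n : ℤ) = k - n + 1 by push_cast; ring, thetaTerm_succ hp0 hz, ← ih,
      Nat.choose_succ_succ' k 1, Nat.choose_one_right, sub_eq_add_neg, zpow_add₀ hp0, zpow_natCast]
    ring

/-- The finite form of the Jacobi triple product. -/
lemma prod_mul_prod_eq_sum (hp0 : p ≠ 0) {z : ℂ} (hz : z ≠ 0) (n : ℕ) :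
    (∏ k ∈ range n, (1 - z * p ^ k)) * ∏ k ∈ range n, (1 - p / z * p ^ k) =
      ∑ k ∈ range (n + n + 1), gaussBinom p (n + n) k * thetaTerm z p (k - n) := by
  have h (k : ℕ) : 1 + -z * p ^ (-n : ℤ) * p ^ (n + k) = 1 - z * p ^ k := by
    rw [pow_add, mul_assoc, ← mul_assoc (p ^ (-n : ℤ)), ← zpow_natCast p n, ← zpow_add₀ hp0]
    simp
    ring
  have := prod_one_add_mul_pow (p := p) (n + n) (-z * p ^ (-n : ℤ))
  simp only [prod_range_add, h] at this
  rw [← thetaTerm_neg_mul_prod hp0 hz, mul_comm, mul_assoc, this, mul_sum]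
  refine sum_congr rfl fun k _ ↦ ?_
  rw [← thetaTerm_neg_mul_pow hp0 hz]
  ring

lemma tendsto_toNat_add (j : ℤ) : Tendsto (fun n : ℕ ↦ ((n : ℤ) + j).toNat) atTop atTop :=
  tendsto_atTop_atTop.2 fun b ↦ ⟨b + j.natAbs, fun n hn ↦ by lia⟩

lemma tendsto_gaussBinom (hp : ‖p‖ < 1) (j : ℤ) :
    Tendsto (fun n : ℕ ↦ gaussBinom p (n + n) (n + j).toNat) atTop (𝓝 (poch p p)⁻¹) := by
  have h0 := poch_self_ne_zero hp
  have h := tendsto_prod_poch hp p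
  have h2 : Tendsto (fun n : ℕ ↦ n + n) atTop atTop := tendsto_id.atTop_add_atTop tendsto_id
  have := ((h.comp h2).mul ((h.comp (tendsto_toNat_add j)).inv₀ h0)).mul
    ((h.comp (tendsto_toNat_add (-j))).inv₀ h0)
  rw [mul_inv_cancel₀ h0, one_mul] at this
  refine this.congr' ?_
  filter_upwards [eventually_ge_atTop j.natAbs] with n hn
  have e : n + n = (n + j).toNat + (n + -j).toNat := by lia
  simp only [Function.comp]
  rw [e, gaussBinom_eq_div hp]

/-- The **Jacobi triple product** identity. -/
theorem tsum_thetaTerm (hp0 : p ≠ 0) (hp : ‖p‖ < 1) {z : ℂ} (hz : z ≠ 0) :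
    ∑' j, thetaTerm z p j = poch p p * theta z p := by
  obtain ⟨C, hC⟩ := exists_norm_gaussBinom_le hp
  let F (n : ℕ) (j : ℤ) : ℂ :=
    if -(n : ℤ) ≤ j then gaussBinom p (n + n) (n + j).toNat * thetaTerm z p j else 0
  have hF (n : ℕ) : ∑' j, F n j =
      (∏ k ∈ range n, (1 - z * p ^ k)) * ∏ k ∈ range n, (1 - p / z * p ^ k) := by
    rw [prod_mul_prod_eq_sum hp0 hz, tsum_eq_sum
      (s := (range (n + n + 1)).image fun k : ℕ ↦ (k - n : ℤ)), sum_image (by simp)]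
    · refine sum_congr rfl fun k _ ↦ ?_
      simp [F]
    · intro j hj
      simp only [F]
      split_ifs with h
      · rw [gaussBinom_eq_zero, zero_mul]
        by_contra! hlt
        refine hj (mem_image.2 ⟨(n + j).toNat, mem_range.2 (by lia), by lia⟩)
      · rfl
  have hlim : Tendsto (fun n ↦ ∑' j, F n j) atTop (𝓝 (∑' j, (poch p p)⁻¹ * thetaTerm z p j)) := by
    refine tendsto_tsum_of_dominated_convergence
      ((summable_thetaTerm hp0 hp hz).norm.mul_left C) (fun j ↦ ?_) (.of_forall fun n j ↦ ?_)
    · refine ((tendsto_gaussBinom hp j).mul_const _).congr' ?_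
      filter_upwards [eventually_ge_atTop j.natAbs] with n hn
      simp only [F]
      rw [if_pos (by lia)]
    · simp only [F]
      split_ifs with h
      · rw [norm_mul]
        gcongr
        exact hC _ _
      · rw [norm_zero]
        exact mul_nonneg ((norm_nonneg _).trans (hC 0 0)) (norm_nonneg _)
  have := tendsto_nhds_unique hlim (((tendsto_prod_poch hp z).mul
    (tendsto_prod_poch hp (p / z))).congr fun n ↦ (hF n).symm)
  rw [tsum_mul_left, inv_mul_eq_iff_eq_mul₀ (poch_self_ne_zero hp)] at this
  exact this

end JacobiTripleProduct

section ParitySplit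

variable {p : ℂ}

/-- Splitting pairs of integers by the parity of their sum. -/
noncomputable def sumEquivProd : (ℤ × ℤ) ⊕ (ℤ × ℤ) ≃ ℤ × ℤ :=
  Equiv.ofBijective (Sum.elim (fun a ↦ (a.1 + a.2, a.1 - a.2)) fun a ↦ (a.1 + a.2, a.1 - a.2 + 1))
    ⟨by
      rintro (⟨a, b⟩ | ⟨a, b⟩) (⟨c, d⟩ | ⟨c, d⟩) h <;>
      simp only [Sum.elim_inl, Sum.elim_inr, Prod.mk.injEq, Sum.inl.injEq, Sum.inr.injEq,
        reduceCtorEq] at h ⊢ <;> lia,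
    by
      rintro ⟨m, n⟩
      rcases Int.even_or_odd' (m + n) with ⟨a, h | h⟩
      · exact ⟨.inl (a, m - a), by simp; lia⟩
      · exact ⟨.inr (a, m - a), by simp; lia⟩⟩

lemma thetaTerm_mul_thetaTerm_even (hp0 : p ≠ 0) {x y : ℂ} (hx : x ≠ 0) (hy : y ≠ 0) (a b : ℤ) :
    thetaTerm (x * y) p (a + b) * thetaTerm (x / y) p (a - b) =
      thetaTerm (-x ^ 2) (p ^ 2) a * thetaTerm (-(p * y ^ 2)) (p ^ 2) b := by
  have h : triangle (a + b) + triangle (a - b) = 2 * triangle a + 2 * triangle b + b := by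
    linarith [two_mul_triangle a, two_mul_triangle b, two_mul_triangle (a + b),
      two_mul_triangle (a - b)]
  have h1 : (-(x * y)) ^ (a + b) * (-(x / y)) ^ (a - b) = x ^ (2 * a) * y ^ (2 * b) := by
    rw [show -(x * y) = -x * y by ring, show -(x / y) = -x * y⁻¹ by ring, mul_zpow, mul_zpow,
      mul_mul_mul_comm, ← zpow_add₀ (neg_ne_zero.2 hx), inv_zpow', ← zpow_add₀ hy,
      show a + b + (a - b) = 2 * a by ring, Even.neg_zpow (even_two_mul a)]
    congr 2
    ring
  simp only [thetaTerm, neg_neg, mul_zpow]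
  rw [mul_mul_mul_comm, h1, ← zpow_add₀ hp0, h, zpow_add₀ hp0, zpow_add₀ hp0, zpow_mul, zpow_mul,
    zpow_mul, zpow_mul]
  simp only [zpow_ofNat]
  ring

lemma thetaTerm_mul_thetaTerm_odd (hp0 : p ≠ 0) {x y : ℂ} (hx : x ≠ 0) (hy : y ≠ 0) (a b : ℤ) :
    thetaTerm (x * y) p (a + b) * thetaTerm (x / y) p (a - b + 1) =
      -(x / y) * (thetaTerm (-(p * x ^ 2)) (p ^ 2) a * thetaTerm (-y ^ 2) (p ^ 2) b) := by
  rw [thetaTerm_succ hp0 (div_ne_zero hx hy), ← mul_assoc, thetaTerm_mul_thetaTerm_even hp0 hx hy]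
  simp only [thetaTerm, neg_neg, mul_zpow, zpow_sub₀ hp0]
  field_simp

/-- The product `θ(xy) θ(x/y)` as an alternating form of rank two. -/
lemma exists_mul_theta_mul_theta_div_eq (hp0 : p ≠ 0) (hp : ‖p‖ < 1) :
    ∃ f g : ℂ → ℂ, ∀ x y : ℂ, x ≠ 0 → y ≠ 0 →
      y * theta (x * y) p * theta (x / y) p = f x * g y - g x * f y := by
  have hP := poch_self_ne_zero hp
  have hp2 : ‖p ^ 2‖ < 1 := by rw [norm_pow]; exact pow_lt_one₀ (norm_nonneg _) hp two_ne_zero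
  have hp20 := pow_ne_zero 2 hp0
  let A (x : ℂ) : ℂ := ∑' j, thetaTerm (-x ^ 2) (p ^ 2) j
  let B (x : ℂ) : ℂ := ∑' j, thetaTerm (-(p * x ^ 2)) (p ^ 2) j
  have hA {x : ℂ} (hx : x ≠ 0) : Summable fun j ↦ ‖thetaTerm (-x ^ 2) (p ^ 2) j‖ :=
    (summable_thetaTerm hp20 hp2 (neg_ne_zero.2 (pow_ne_zero 2 hx))).norm
  have hB {x : ℂ} (hx : x ≠ 0) : Summable fun j ↦ ‖thetaTerm (-(p * x ^ 2)) (p ^ 2) j‖ :=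
    (summable_thetaTerm hp20 hp2 (neg_ne_zero.2 (mul_ne_zero hp0 (pow_ne_zero 2 hx)))).norm
  refine ⟨fun x ↦ A x / poch p p ^ 2, fun x ↦ x * B x, fun x y hx hy ↦ ?_⟩
  have h1 := (summable_thetaTerm hp0 hp (mul_ne_zero hx hy)).norm
  have h2 := (summable_thetaTerm hp0 hp (div_ne_zero hx hy)).norm
  have key : (poch p p * theta (x * y) p) * (poch p p * theta (x / y) p) =
      A x * B y + -(x / y) * (B x * A y) := by
    rw [← tsum_thetaTerm hp0 hp (mul_ne_zero hx hy), ← tsum_thetaTerm hp0 hp (div_ne_zero hx hy),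
      tsum_mul_tsum_of_summable_norm h1 h2, ← sumEquivProd.tsum_eq]
    refine HasSum.tsum_eq (.sum ?_ ?_)
    · simp only [A, B, tsum_mul_tsum_of_summable_norm (hA hx) (hB hy)]
      exact ((summable_mul_of_summable_norm (hA hx) (hB hy)).hasSum).congr_fun
        fun c ↦ thetaTerm_mul_thetaTerm_even hp0 hx hy c.1 c.2
    · simp only [A, B, tsum_mul_tsum_of_summable_norm (hB hx) (hA hy)]
      exact ((summable_mul_of_summable_norm (hB hx) (hA hy)).hasSum.mul_left _).congr_fun
        fun c ↦ thetaTerm_mul_thetaTerm_odd hp0 hx hy c.1 c.2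
  have : theta (x * y) p * theta (x / y) p =
      (A x * B y + -(x / y) * (B x * A y)) / poch p p ^ 2 := by
    rw [← key]
    field_simp
  rw [mul_assoc, this]
  field_simp
  ring

end ParitySplit

section ThreeTerm

variable {p : ℂ}

lemma hasDerivAt_mul_theta_mul_theta_div (hp0 : p ≠ 0) (hp : ‖p‖ < 1) {x u : ℂ} (hx : x ≠ 0)
    (hu : u ≠ 0) (h1 : theta (x * u) p ≠ 0) (h2 : theta (x / u) p ≠ 0) :
    HasDerivAt (fun v ↦ v * theta (x * v) p * theta (x / v) p)
      (theta (x * u) p * theta (x / u) p *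
        (1 + thetaLogDeriv (x * u) p - thetaLogDeriv (x / u) p)) u := by
  have hd : HasDerivAt (fun z ↦ x / z) (-x / u ^ 2) u := by
    simpa [div_eq_mul_inv] using (hasDerivAt_inv hu).const_mul x
  have hm : HasDerivAt (fun z ↦ x * z) x u := by simpa using (hasDerivAt_id u).const_mul x
  have h3 := (hasDerivAt_theta hp0 hp (mul_ne_zero hx hu) h1).comp u hm
  have h4 := (hasDerivAt_theta hp0 hp (div_ne_zero hx hu) h2).comp u hd
  refine (((hasDerivAt_id u).mul h3).mul h4).congr_deriv ?_
  simp only [Pi.mul_apply, Function.comp, id]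
  field_simp
  ring

lemma hasDerivAt_mul_theta_mul_theta_div_self (hp0 : p ≠ 0) (hp : ‖p‖ < 1) {u : ℂ}
    (hu : u ≠ 0) (h1 : theta (u * u) p ≠ 0) :
    HasDerivAt (fun v ↦ v * theta (u * v) p * theta (u / v) p)
      (theta (u * u) p * poch p p ^ 2) u := by
  have hd : HasDerivAt (fun z ↦ u / z) (-u / u ^ 2) u := by
    simpa [div_eq_mul_inv] using (hasDerivAt_inv hu).const_mul u
  have hm : HasDerivAt (fun z ↦ u * z) u u := by simpa using (hasDerivAt_id u).const_mul u
  have h3 := (hasDerivAt_theta hp0 hp (mul_ne_zero hu hu) h1).comp u hm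
  have h5 : HasDerivAt (theta · p) (-poch p p ^ 2) (u / u) := by
    rw [div_self hu]; exact hasDerivAt_theta_one hp
  have h4 := h5.comp u hd
  refine (((hasDerivAt_id u).mul h3).mul h4).congr_deriv ?_
  have h0 : theta 1 p = 0 := by rw [theta_eq_one_sub_mul hp, sub_self, zero_mul]
  simp only [Pi.mul_apply, Function.comp, id, div_self hu, h0]
  field_simp
  ring

/-- The equal-argument case of the addition formula
`ζ(a) + ζ(b) + ζ(c) - ζ(a+b+c) = σ(a+b)σ(b+c)σ(c+a) / (σ(a)σ(b)σ(c)σ(a+b+c))`. -/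
theorem theta_sq_pow_three (hp0 : p ≠ 0) (hp : ‖p‖ < 1) {t : ℂ} (ht : t ≠ 0)
    (h1 : theta t p ≠ 0) (h2 : theta (t ^ 2) p ≠ 0) (h3 : theta (t ^ 3) p ≠ 0) :
    poch p p ^ 2 * theta (t ^ 2) p ^ 3 = theta t p ^ 3 * theta (t ^ 3) p *
      (1 - 3 * thetaLogDeriv t p + thetaLogDeriv (t ^ 3) p) := by
  obtain ⟨f, g, hfg⟩ := exists_mul_theta_mul_theta_div_eq hp0 hp
  have ht1 : t ≠ 1 := by
    rintro rfl
    exact h1 (by rw [theta_eq_one_sub_mul hp, sub_self, zero_mul])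
  have hti : theta (1 / t) p = -theta t p / t := by rw [one_div, theta_inv hp ht]
  have hJi : thetaLogDeriv (1 / t) p = 1 - thetaLogDeriv t p := by
    rw [one_div, thetaLogDeriv_inv hp0 hp ht ht1]
  have hti2 : theta (1 / t ^ 2) p = -theta (t ^ 2) p / t ^ 2 := by
    rw [one_div, theta_inv hp (pow_ne_zero 2 ht)]
  have e1 : t ^ 2 * t = t ^ 3 := by ring
  have e2 : t ^ 2 / t = t := by field_simp
  have d1 := hasDerivAt_mul_theta_mul_theta_div_self hp0 hp ht (by rwa [← sq])
  have d2 := hasDerivAt_mul_theta_mul_theta_div hp0 hp (x := t ^ 2) (u := t) (pow_ne_zero 2 ht) ht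
    (by rwa [e1]) (by rwa [e2])
  have d3 := hasDerivAt_mul_theta_mul_theta_div hp0 hp (x := 1) (u := t) one_ne_zero ht
    (by rwa [one_mul]) (by rw [hti]; exact div_ne_zero (neg_ne_zero.2 h1) ht)
  have d := ((d1.const_mul (t ^ 2 * theta (1 * t ^ 2) p * theta (1 / t ^ 2) p)).sub
    (d2.const_mul (t * theta (1 * t) p * theta (1 / t) p))).add
    (d3.mul_const (t * theta (t ^ 2 * t) p * theta (t ^ 2 / t) p))
  have d0 := d.unique ((hasDerivAt_const t 0).congr_of_eventuallyEq ?_)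
  · simp only [one_mul, hti, hti2, hJi, e1, e2, ← sq] at d0
    field_simp at d0
    linear_combination -d0
  · filter_upwards [isOpen_ne.mem_nhds ht] with v hv
    simp only [Pi.add_apply, Pi.sub_apply]
    rw [hfg _ _ one_ne_zero (pow_ne_zero 2 ht), hfg _ _ ht hv, hfg _ _ one_ne_zero ht,
      hfg _ _ (pow_ne_zero 2 ht) hv, hfg _ _ one_ne_zero hv, hfg _ _ (pow_ne_zero 2 ht) ht]
    ring

end ThreeTerm

section Lambert

variable {a p : ℂ}

lemma hasSum_lambert (ha : ‖a‖ < 1) (hp : ‖p‖ < 1) :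
    HasSum (fun m : ℕ ↦ a ^ (m + 1) / (1 - p ^ (m + 1))) (lambert a p) := by
  have hs : Summable fun x : ℕ × ℕ ↦ (a * p ^ x.1) ^ (x.2 + 1) := by
    refine .of_norm_bounded (g := fun x : ℕ × ℕ ↦ ‖p‖ ^ x.1 * ‖a‖ ^ x.2)
      ((summable_geometric_of_lt_one (norm_nonneg p) hp).mul_of_nonneg
        (summable_geometric_of_lt_one (norm_nonneg a) ha) (fun _ ↦ by positivity)
        fun _ ↦ by positivity) fun ⟨n, m⟩ ↦ ?_
    rw [mul_pow, norm_mul, norm_pow, norm_pow, norm_pow, mul_comm, ← pow_mul]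
    exact mul_le_mul (pow_le_pow_of_le_one (norm_nonneg _) hp.le (by nlinarith))
      (pow_le_pow_of_le_one (norm_nonneg _) ha.le m.le_succ) (by positivity) (by positivity)
  have h1 (n : ℕ) : ∑' m : ℕ, (a * p ^ n) ^ (m + 1) = a * p ^ n / (1 - a * p ^ n) := by
    have : ‖a * p ^ n‖ < 1 := by
      rw [norm_mul, norm_pow]
      exact mul_lt_one_of_nonneg_of_lt_one_left (norm_nonneg _) ha
        (pow_le_one₀ (norm_nonneg _) hp.le)
    simp_rw [pow_succ', tsum_mul_left, tsum_geometric_of_norm_lt_one this, div_eq_mul_inv]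
  have h2 (m : ℕ) : ∑' n : ℕ, (a * p ^ n) ^ (m + 1) = a ^ (m + 1) / (1 - p ^ (m + 1)) := by
    have : ‖p ^ (m + 1)‖ < 1 := by
      rw [norm_pow]
      exact pow_lt_one₀ (norm_nonneg _) hp m.succ_ne_zero
    simp_rw [mul_pow, ← pow_mul, mul_comm _ (m + 1), pow_mul p, tsum_mul_left,
      tsum_geometric_of_norm_lt_one this, div_eq_mul_inv]
  have h3 : Summable fun m : ℕ ↦ ∑' n : ℕ, (a * p ^ n) ^ (m + 1) := hs.prod_symm.prod
  have h4 : ∑' (m : ℕ) (n : ℕ), (a * p ^ n) ^ (m + 1) =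
      ∑' (n : ℕ) (m : ℕ), (a * p ^ n) ^ (m + 1) :=
    Summable.tsum_comm (f := fun n m : ℕ ↦ (a * p ^ n) ^ (m + 1)) hs
  simp only [h1, h2] at h3 h4
  rw [lambert, ← h4]
  exact h3.hasSum

end Lambert

lemma poch_pow_ne_zero {q : ℂ} (hq : ‖q‖ < 1) {i : ℕ} (hi : i ≠ 0) (k : ℕ) (hk : k ≠ 0) :
    poch (q ^ i) (q ^ k) ≠ 0 := by
  refine poch_ne_zero (by rw [norm_pow]; exact pow_lt_one₀ (norm_nonneg _) hq hk) fun n h ↦ ?_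
  have : ‖q ^ (i + k * n)‖ < 1 := by
    rw [norm_pow]
    exact pow_lt_one₀ (norm_nonneg _) hq (by lia)
  rw [pow_add, pow_mul, h] at this
  simp at this

/-- Lemma 2.3, identity (2.21-1): for `0 < |q| < 1`,
`∑_{n≥1} (qⁿ − 2q^{2n} + 2q^{3n} − q^{4n})/(1 − q^{5n})
  = (1/10)(q², q³, q⁵; q⁵)_∞² / (q, q⁴; q⁵)_∞³
    + (7q/10)(q, q⁴, q⁵; q⁵)_∞² / (q², q³; q⁵)_∞³ − 1/10`. -/
theorem statement_16 (q : ℂ) (hq0 : q ≠ 0) (hq : ‖q‖ < 1) :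
    (∑' n : ℕ, (q ^ (n + 1) - 2 * q ^ (2 * (n + 1)) + 2 * q ^ (3 * (n + 1))
        - q ^ (4 * (n + 1))) / (1 - q ^ (5 * (n + 1))))
    = 1 / 10 * (poch (q ^ 2) (q ^ 5) * poch (q ^ 3) (q ^ 5)
          * poch (q ^ 5) (q ^ 5)) ^ 2
        / (poch q (q ^ 5) * poch (q ^ 4) (q ^ 5)) ^ 3
      + 7 * q / 10 * (poch q (q ^ 5) * poch (q ^ 4) (q ^ 5)
          * poch (q ^ 5) (q ^ 5)) ^ 2
        / (poch (q ^ 2) (q ^ 5) * poch (q ^ 3) (q ^ 5)) ^ 3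
      - 1 / 10 := by
  have hpow {i : ℕ} (hi : i ≠ 0) : ‖q ^ i‖ < 1 := by
    rw [norm_pow]
    exact pow_lt_one₀ (norm_nonneg _) hq hi
  have hne {i : ℕ} (hi : i ≠ 0) : q ^ i ≠ 1 := fun h ↦ by simpa [h] using hpow hi
  have hp := hpow (i := 5) (by simp)
  have hp0 : q ^ 5 ≠ 0 := pow_ne_zero 5 hq0
  have hL {i : ℕ} (hi : i ≠ 0) := hasSum_lambert (hpow hi) hp
  have hsum := (((hL one_ne_zero).sub ((hL two_ne_zero).mul_left 2)).add
    ((hL three_ne_zero).mul_left 2)).sub (hL four_ne_zero)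
  have hlhs := hsum.tsum_eq
  have e1 : q ^ 5 / q = q ^ 4 := by field_simp
  have e2 : q ^ 5 / q ^ 2 = q ^ 3 := by field_simp
  have t1 : theta q (q ^ 5) = poch q (q ^ 5) * poch (q ^ 4) (q ^ 5) := by rw [theta, e1]
  have t2 : theta (q ^ 2) (q ^ 5) = poch (q ^ 2) (q ^ 5) * poch (q ^ 3) (q ^ 5) := by
    rw [theta, e2]
  have n1 : theta q (q ^ 5) ≠ 0 := by
    rw [t1]
    exact mul_ne_zero (by simpa using poch_pow_ne_zero hq one_ne_zero 5 (by simp))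
      (poch_pow_ne_zero hq (by simp) 5 (by simp))
  have n2 : theta (q ^ 2) (q ^ 5) ≠ 0 := by
    rw [t2]
    exact mul_ne_zero (poch_pow_ne_zero hq (by simp) 5 (by simp))
      (poch_pow_ne_zero hq (by simp) 5 (by simp))
  have t3 : theta (q ^ 3) (q ^ 5) = theta (q ^ 2) (q ^ 5) := by rw [← e2, theta_div_self hp0]
  have t4 : theta (q ^ 4) (q ^ 5) = theta q (q ^ 5) := by rw [← e1, theta_div_self hp0]
  have t6 : theta (q ^ 6) (q ^ 5) = -theta q (q ^ 5) / q := by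
    rw [← theta_mul_self hp0 hp hq0, ← pow_succ]
  have j3 : thetaLogDeriv (q ^ 3) (q ^ 5) = -thetaLogDeriv (q ^ 2) (q ^ 5) := by
    rw [← e2, thetaLogDeriv_div_self hp0]
  have j6 : thetaLogDeriv (q ^ 6) (q ^ 5) = thetaLogDeriv q (q ^ 5) - 1 := by
    rw [← thetaLogDeriv_mul_self hp0 hp hq0 (by simpa using hne one_ne_zero), ← pow_succ]
  have A := theta_sq_pow_three hp0 hp hq0 n1 n2 (by rwa [t3])
  have B := theta_sq_pow_three hp0 hp (pow_ne_zero 2 hq0) n2 (by rwa [← pow_mul, t4])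
    (by rw [← pow_mul, t6]; exact div_ne_zero (neg_ne_zero.2 n1) hq0)
  simp only [← pow_mul, Nat.reduceMul, t3, t4, t6, j3, j6] at A B
  have A' : (theta (q ^ 2) (q ^ 5) * poch (q ^ 5) (q ^ 5)) ^ 2 / theta q (q ^ 5) ^ 3 =
      1 - 3 * thetaLogDeriv q (q ^ 5) - thetaLogDeriv (q ^ 2) (q ^ 5) := by
    rw [div_eq_iff (pow_ne_zero 3 n1)]
    refine mul_left_cancel₀ n2 ?_
    linear_combination A
  have B' : q * (theta q (q ^ 5) * poch (q ^ 5) (q ^ 5)) ^ 2 / theta (q ^ 2) (q ^ 5) ^ 3 =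
      3 * thetaLogDeriv (q ^ 2) (q ^ 5) - thetaLogDeriv q (q ^ 5) := by
    rw [div_eq_iff (pow_ne_zero 3 n2)]
    refine mul_left_cancel₀ n1 ?_
    field_simp at B
    linear_combination theta q (q ^ 5) * B
  have hJ1 : thetaLogDeriv q (q ^ 5) = lambert (q ^ 4) (q ^ 5) - lambert q (q ^ 5) := by
    rw [thetaLogDeriv, e1]
  have hJ2 : thetaLogDeriv (q ^ 2) (q ^ 5) = lambert (q ^ 3) (q ^ 5) - lambert (q ^ 2) (q ^ 5) := by
    rw [thetaLogDeriv, e2]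
  rw [← t1, ← t2]
  trans lambert q (q ^ 5) - 2 * lambert (q ^ 2) (q ^ 5) + 2 * lambert (q ^ 3) (q ^ 5) -
    lambert (q ^ 4) (q ^ 5)
  · rw [pow_one] at hlhs
    rw [← hlhs]
    refine tsum_congr fun n ↦ ?_
    simp only [← pow_mul]
    ring
  · rw [mul_div_assoc (1 / 10 : ℂ), A', mul_div_right_comm 7 q, mul_assoc, mul_div_assoc, B', hJ1, hJ2]
    ring

end Beck
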